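/- arXiv:0906.2738 — 4 statements merged into one kernel-verified Lean document; each statement's English description precedes it below -/
import Mathlib

section
/- Let P be a finite set of points in ℝ², let α > 1 be a real number, and let M₁, …, M_s be finite sets of points in ℝ² such that: (i) for every i and every m ∈ M_i, the number of points of P dominating m is at least α^i and at most α^{i+1}; (ii) for every i and every q ∈ ℝ², either q dominates some point of M_i or some point of M_i dominates q. If j > 1 is the minimal index such that q dominates some point of M_j, then the number k of points of P dominating q satisfies α^{j-1} ≤ k ≤ α^{j+1}. -/
open Set

/-- If `a` lies below `b`, every point dominating `b` dominates `a`, so at least as many points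
of a finite set dominate `a` as dominate `b`. -/
theorem ncard_dominating_le {P : Set (ℝ × ℝ)} (hP : P.Finite) {a b : ℝ × ℝ}
    (hab : a.1 ≤ b.1 ∧ a.2 ≤ b.2) :
    ({p ∈ P | b.1 ≤ p.1 ∧ b.2 ≤ p.2}.ncard : ℝ) ≤
      ({p ∈ P | a.1 ≤ p.1 ∧ a.2 ≤ p.2}.ncard : ℝ) := by
  refine Nat.cast_le.2 (Set.ncard_le_ncard ?_ (hP.subset (Set.sep_subset _ _)))
  exact fun p hp => ⟨hp.1, hab.1.trans hp.2.1, hab.2.trans hp.2.2⟩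

/-- If `M i` is an `α^i`-approximate boundary for `P` (each of its points is dominated by
at least `α^i` and at most `α^(i+1)` points of `P`, and every query point either dominates
a point of `M i` or is dominated by one), and `j > 1` is the minimal index such that the
query point `q` dominates some point of `M j`, then the number `k` of points of `P`
dominating `q` satisfies `α^(j-1) ≤ k ≤ α^(j+1)`. -/
theorem stmt1 (P : Set (ℝ × ℝ)) (hP : P.Finite) (α : ℝ) (hα : 1 < α)
    (s : ℕ) (M : ℕ → Set (ℝ × ℝ))
    (h1 : ∀ i ∈ Finset.Icc 1 s, ∀ m ∈ M i,
      α ^ i ≤ ({p ∈ P | m.1 ≤ p.1 ∧ m.2 ≤ p.2}.ncard : ℝ) ∧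
      ({p ∈ P | m.1 ≤ p.1 ∧ m.2 ≤ p.2}.ncard : ℝ) ≤ α ^ (i + 1))
    (h2 : ∀ i ∈ Finset.Icc 1 s, ∀ q : ℝ × ℝ,
      (∃ m ∈ M i, m.1 ≤ q.1 ∧ m.2 ≤ q.2) ∨ (∃ m ∈ M i, q.1 ≤ m.1 ∧ q.2 ≤ m.2))
    (q : ℝ × ℝ) (j : ℕ) (hj1 : 1 < j) (hjs : j ≤ s)
    (hdom : ∃ m ∈ M j, m.1 ≤ q.1 ∧ m.2 ≤ q.2)
    (hmin : ∀ i, 1 ≤ i → i < j → ¬ ∃ m ∈ M i, m.1 ≤ q.1 ∧ m.2 ≤ q.2) :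
    α ^ (j - 1) ≤ ({p ∈ P | q.1 ≤ p.1 ∧ q.2 ≤ p.2}.ncard : ℝ) ∧
    ({p ∈ P | q.1 ≤ p.1 ∧ q.2 ≤ p.2}.ncard : ℝ) ≤ α ^ (j + 1) := by
  constructor
  · have hj : j - 1 ∈ Finset.Icc 1 s := Finset.mem_Icc.2 (by omega)
    obtain ⟨m, hm, hqm⟩ :=
      (h2 (j - 1) hj q).resolve_left (hmin (j - 1) (by omega) (by omega))
    exact (h1 _ hj m hm).1.trans (ncard_dominating_le hP hqm)
  · obtain ⟨m, hm, hmq⟩ := hdom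
    exact (ncard_dominating_le hP hmq).trans
      (h1 j (Finset.mem_Icc.2 ⟨hj1.le, hjs⟩) m hm).2
end

section
/- Let n ≥ 2 be a real number, let ρ be a real with 0 < ρ < 1, and set v = ⌈log₂(1/ρ)⌉ + 2. If 8/ρ ≤ n^{3ρ/4}, then 2^v · n^{1/2^v} ≤ n^ρ. -/
/-- Choice of recursion depth in Lemma 3: for `n ≥ 2`, `0 < ρ < 1` and
`v = ⌈log₂(1/ρ)⌉ + 2`, if `8/ρ ≤ n^(3ρ/4)` then `2^v · n^(1/2^v) ≤ n^ρ`. -/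
theorem stmt8 (n ρ : ℝ) (hn : 2 ≤ n) (hρ0 : 0 < ρ) (hρ1 : ρ < 1)
    (v : ℤ) (hv : v = ⌈Real.logb 2 (1 / ρ)⌉ + 2)
    (h : 8 / ρ ≤ n ^ (3 * ρ / 4)) :
    (2 : ℝ) ^ v * n ^ (1 / (2 : ℝ) ^ v) ≤ n ^ ρ := by
  have hpos : 0 < 1 / ρ := by positivity
  have hpow : (2 : ℝ) ^ Real.logb 2 (1 / ρ) = 1 / ρ :=
    Real.rpow_logb (by norm_num) (by norm_num) hpos
  have hlower : 4 / ρ ≤ (2 : ℝ) ^ v := by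
    have hle : Real.logb 2 (1 / ρ) + 2 ≤ (v : ℝ) := by
      rw [hv]
      push_cast
      linarith [Int.le_ceil (Real.logb 2 (1 / ρ))]
    calc 4 / ρ = (2 : ℝ) ^ (Real.logb 2 (1 / ρ) + 2) := by
          rw [Real.rpow_add (by norm_num), hpow]
          norm_num
          ring
      _ ≤ (2 : ℝ) ^ (v : ℝ) := Real.rpow_le_rpow_of_exponent_le (by norm_num) hle
      _ = (2 : ℝ) ^ v := Real.rpow_intCast 2 v
  have hupper : (2 : ℝ) ^ v ≤ 8 / ρ := by
    have hle : (v : ℝ) ≤ Real.logb 2 (1 / ρ) + 3 := by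
      rw [hv]
      push_cast
      linarith [Int.ceil_lt_add_one (Real.logb 2 (1 / ρ))]
    calc (2 : ℝ) ^ v = (2 : ℝ) ^ (v : ℝ) := (Real.rpow_intCast 2 v).symm
      _ ≤ (2 : ℝ) ^ (Real.logb 2 (1 / ρ) + 3) :=
          Real.rpow_le_rpow_of_exponent_le (by norm_num) hle
      _ = 8 / ρ := by
          rw [Real.rpow_add (by norm_num), hpow]
          norm_num
          ring
  have hexp : 1 / (2 : ℝ) ^ v ≤ ρ / 4 := by
    simpa using one_div_le_one_div_of_le (by positivity) hlower
  calc (2 : ℝ) ^ v * n ^ (1 / (2 : ℝ) ^ v)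
      ≤ n ^ (3 * ρ / 4) * n ^ (ρ / 4) := by
        gcongr
        · exact hupper.trans h
        · linarith
    _ = n ^ ρ := by
        rw [← Real.rpow_add (by linarith)]
        ring_nf
end

section
/- Let c > 1 be a real number, let L be a positive natural number, and for each i ∈ {1, …, L} let a_i, k_i, s_i be real numbers with a_i ≥ 1, k_i ≥ a_i^{(c-1)/c}, and |s_i − k_i| ≤ a_i^{3/c}. Set k = k₁ + ⋯ + k_L and s = s₁ + ⋯ + s_L. If L ≤ k^{1/(c-1)}, then |s − k| ≤ k^{4/(c-1)}. -/
/-- Accumulated-error analysis of Theorem 1: a query visits `L` nodes; at node `i`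
containing `a i ≥ 1` points, the stored count `s i` approximates the true contribution
`k i ≥ (a i)^((c-1)/c)` with additive error `(a i)^(3/c)`.  If `L ≤ k^(1/(c-1))` for
`k = ∑ k i`, then the total estimate `s = ∑ s i` satisfies `|s - k| ≤ k^(4/(c-1))`. -/
theorem stmt12 (c : ℝ) (hc : 1 < c) (L : ℕ) (hL : 0 < L)
    (a k s : Fin L → ℝ)
    (ha : ∀ i, 1 ≤ a i)
    (hk : ∀ i, (a i) ^ ((c - 1) / c) ≤ k i)
    (hs : ∀ i, |s i - k i| ≤ (a i) ^ (3 / c))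
    (hLk : (L : ℝ) ≤ (∑ i, k i) ^ (1 / (c - 1))) :
    |(∑ i, s i) - (∑ i, k i)| ≤ (∑ i, k i) ^ (4 / (c - 1)) := by
  have hc1 : 0 < c - 1 := sub_pos.mpr hc
  have hc0 : 0 < c := one_pos.trans hc
  have hk1 : ∀ i, 1 ≤ k i := fun i =>
    (Real.one_le_rpow (ha i) (div_pos hc1 hc0).le).trans (hk i)
  have hk0 : ∀ i, 0 ≤ k i := fun i => zero_le_one.trans (hk1 i)
  have hle : ∀ i, k i ≤ ∑ j, k j := fun i =>
    Finset.single_le_sum (fun j _ => hk0 j) (Finset.mem_univ i)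
  have hpos : 0 < ∑ j, k j := one_pos.trans_le ((hk1 ⟨0, hL⟩).trans (hle _))
  have herr : ∀ i, |s i - k i| ≤ (∑ j, k j) ^ (3 / (c - 1)) := fun i =>
    calc |s i - k i| ≤ (a i) ^ (3 / c) := hs i
      _ = ((a i) ^ ((c - 1) / c)) ^ (3 / (c - 1)) := by
        rw [← Real.rpow_mul (zero_le_one.trans (ha i))]
        congr 1
        field_simp
      _ ≤ (∑ j, k j) ^ (3 / (c - 1)) :=
        Real.rpow_le_rpow (Real.rpow_nonneg (zero_le_one.trans (ha i)) _)
          ((hk i).trans (hle i)) (by positivity)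
  calc |(∑ i, s i) - (∑ i, k i)| = |∑ i, (s i - k i)| := by rw [Finset.sum_sub_distrib]
    _ ≤ ∑ i, |s i - k i| := Finset.abs_sum_le_sum_abs _ _
    _ ≤ ∑ _i : Fin L, (∑ j, k j) ^ (3 / (c - 1)) := Finset.sum_le_sum fun i _ => herr i
    _ = L * (∑ j, k j) ^ (3 / (c - 1)) := by simp
    _ ≤ (∑ j, k j) ^ (1 / (c - 1)) * (∑ j, k j) ^ (3 / (c - 1)) := by gcongr
    _ = (∑ j, k j) ^ (4 / (c - 1)) := by
      rw [← Real.rpow_add hpos, ← add_div]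
      norm_num
end

section
/- Let C ≥ 0 be a real number and let f : ℝ → ℝ be a function such that f(x) ≤ C·x for all real x with 2 ≤ x ≤ 4, and f(x) ≤ C·x + 2·x^{1/2}·f(x^{1/2}) for all real x > 4. Then f(x) ≤ C·x·(2·log₂ x − 1) for all x ≥ 2; in particular f(x) = O(x log x). -/
/-- Solution of the 2-D space recurrence `s(n) = O(n) + 2·n^(1/2)·s(n^(1/2))`:
if `f x ≤ C·x` for `2 ≤ x ≤ 4` and `f x ≤ C·x + 2·x^(1/2)·f(x^(1/2))` for `x > 4`,
then `f x ≤ C·x·(2·log₂ x - 1)` for all `x ≥ 2`. -/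
theorem stmt13 (C : ℝ) (hC : 0 ≤ C) (f : ℝ → ℝ)
    (h1 : ∀ x : ℝ, 2 ≤ x → x ≤ 4 → f x ≤ C * x)
    (h2 : ∀ x : ℝ, 4 < x →
      f x ≤ C * x + 2 * x ^ ((1 : ℝ) / 2) * f (x ^ ((1 : ℝ) / 2))) :
    ∀ x : ℝ, 2 ≤ x → f x ≤ C * x * (2 * Real.logb 2 x - 1) := by
  suffices h : ∀ n : ℕ, ∀ x : ℝ, 2 ≤ x → x ≤ n → f x ≤ C * x * (2 * Real.logb 2 x - 1) by
    intro x hx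
    obtain ⟨n, hn⟩ := exists_nat_ge x
    exact h n x hx hn
  intro n
  induction n with
  | zero =>
    intro x hx hn
    norm_num at hn
    linarith
  | succ n ih =>
    intro x hx hn
    push_cast at hn
    rcases le_or_gt x 4 with h4 | h4
    · have hlog : 1 ≤ Real.logb 2 x := by
        rw [Real.le_logb_iff_rpow_le (by norm_num) (by linarith)]
        simpa using hx
      have hCx : 0 ≤ C * x := by positivity
      nlinarith [h1 x hx h4]
    · have hf := h2 x h4
      have hlog : Real.logb 2 (x ^ ((1 : ℝ) / 2)) = 1 / 2 * Real.logb 2 x :=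
        Real.logb_rpow_eq_mul_logb_of_pos (by linarith)
      have hsq : x ^ ((1 : ℝ) / 2) * x ^ ((1 : ℝ) / 2) = x := by
        rw [← Real.sqrt_eq_rpow]
        exact Real.mul_self_sqrt (by linarith)
      have hpos : 0 ≤ x ^ ((1 : ℝ) / 2) := by positivity
      generalize x ^ ((1 : ℝ) / 2) = s at hf hlog hsq hpos
      have hs : 2 < s := by nlinarith
      have hrec := ih s hs.le (by nlinarith)
      rw [hlog] at hrec
      calc f x ≤ C * x + 2 * s * f s := hf
        _ ≤ C * x + 2 * s * (C * s * (2 * (1 / 2 * Real.logb 2 x) - 1)) := by gcongr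
        _ = C * x + 2 * C * (s * s) * (Real.logb 2 x - 1) := by ring
        _ = C * x * (2 * Real.logb 2 x - 1) := by rw [hsq]; ring
end
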